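/- arXiv:2506.12362 — 2 statements merged into one kernel-verified Lean document; each statement's English description precedes it below -/
import Mathlib

section
/- Fix an even integer d ≥ 4 such that 10^(8/d) is irrational. Then the sinusoidal positional encoding p : ℝ → ℝ^d is injective; in particular its restriction to the positive integers is injective. -/
/-- The frequency `ω_i = 10000 ^ (-2 i / d)`. -/
noncomputable def omegaFreq (d i : ℕ) : ℝ :=
  (10000 : ℝ) ^ (-(2 * (i : ℝ)) / (d : ℝ))

/-- Sinusoidal positional encoding `p : ℝ → ℝ^d`, with
`(p_a)_{2i} = sin(ω_i a)` and `(p_a)_{2i+1} = cos(ω_i a)`. -/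
noncomputable def posEnc (d : ℕ) (a : ℝ) : EuclideanSpace ℝ (Fin d) :=
  (WithLp.equiv 2 (Fin d → ℝ)).symm fun j =>
    if j.val % 2 = 0 then Real.sin (omegaFreq d (j.val / 2) * a)
    else Real.cos (omegaFreq d (j.val / 2) * a)

/-- The second frequency is the inverse of the ratio `10 ^ (8 / d)` of consecutive frequencies. -/
theorem omegaFreq_one (d : ℕ) : omegaFreq d 1 = ((10 : ℝ) ^ ((8 : ℝ) / (d : ℝ)))⁻¹ := by
  have h : (10000 : ℝ) = (10 : ℝ) ^ (4 : ℝ) := by norm_num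
  rw [omegaFreq, h, ← Real.rpow_mul (by norm_num), ← Real.rpow_neg (by norm_num)]
  congr 1
  push_cast
  ring

/-- Equal encodings have arguments which agree modulo the period of each frequency. -/
theorem exists_int_of_posEnc_eq {d i : ℕ} (hi : 2 * i + 1 < d) {a b : ℝ}
    (h : posEnc d a = posEnc d b) :
    ∃ k : ℤ, omegaFreq d i * a - omegaFreq d i * b = 2 * Real.pi * k := by
  have hs := congrArg (fun v : EuclideanSpace ℝ (Fin d) => v ⟨2 * i, by omega⟩) h
  have hc := congrArg (fun v : EuclideanSpace ℝ (Fin d) => v ⟨2 * i + 1, hi⟩) h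
  have hdiv : (2 * i + 1) / 2 = i := by omega
  have hmod : (2 * i + 1) % 2 = 1 := by omega
  simp only [posEnc, WithLp.equiv_symm_apply, Nat.mul_mod_right, if_true,
    Nat.mul_div_cancel_left i two_pos] at hs
  simp only [posEnc, WithLp.equiv_symm_apply, hdiv, hmod, one_ne_zero, if_false] at hc
  exact Real.Angle.angle_eq_iff_two_pi_dvd_sub.mp (Real.Angle.cos_sin_inj hc hs)

/-- For an even integer `d ≥ 4` with `10 ^ (8/d)` irrational, the sinusoidal
positional encoding `p : ℝ → ℝ^d` is injective; in particular its restriction to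
the positive integers is injective. -/
theorem posEnc_injective (d : ℕ) (heven : Even d) (hd : 4 ≤ d)
    (hirr : Irrational ((10 : ℝ) ^ ((8 : ℝ) / (d : ℝ)))) :
    Function.Injective (posEnc d) ∧
      Function.Injective (fun a : ℕ+ => posEnc d (a : ℝ)) := by
  have hinj : Function.Injective (posEnc d) := by
    intro a b h
    obtain ⟨m, hm⟩ := exists_int_of_posEnc_eq (i := 0) (by omega) h
    obtain ⟨n, hn⟩ := exists_int_of_posEnc_eq (i := 1) (by omega) h
    have h0 : omegaFreq d 0 = 1 := by simp [omegaFreq]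
    rw [h0, one_mul, one_mul] at hm
    rw [← mul_sub, hm, mul_left_comm] at hn
    have hmn : omegaFreq d 1 * m = n := mul_left_cancel₀ Real.two_pi_pos.ne' hn
    have hm0 : m = 0 := by
      by_contra hne
      have hω : Irrational (omegaFreq d 1) := by
        rw [omegaFreq_one]
        exact hirr.inv
      exact (hω.mul_intCast hne).ne_int n hmn
    rw [hm0, Int.cast_zero, mul_zero] at hm
    exact sub_eq_zero.mp hm
  refine ⟨hinj, fun a b h => ?_⟩
  exact PNat.eq (Nat.cast_injective (hinj h))
end

section
/- Fix an even integer d ≥ 4 such that 10^(8/d) is irrational, and let n ≥ 2d and m ≥ 2d. Then there exist parameters W₁ ∈ ℝ^{n×2d}, b₁ ∈ ℝ^n, W₂ ∈ ℝ^{m×n}, b₂ ∈ ℝ^m such that the positional–interaction encoder Enc_PI : ℕ_{>0} × ℕ_{>0} → ℝ^m, Enc_PI(a,b) = MLP([p_a ‖ p_b]), is injective: for all positive integers a, b, a', b', if (a,b) ≠ (a',b') then Enc_PI(a,b) ≠ Enc_PI(a',b'). -/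
/-- Concatenated encoding `E(a,b) = [p_a ‖ p_b] ∈ ℝ^{2d}`. -/
noncomputable def concatEnc (d : ℕ) (a b : ℝ) : EuclideanSpace ℝ (Fin (2 * d)) :=
  (WithLp.equiv 2 (Fin (2 * d) → ℝ)).symm fun j =>
    if h : j.val < d then WithLp.equiv 2 (Fin d → ℝ) (posEnc d a) ⟨j.val, h⟩
    else WithLp.equiv 2 (Fin d → ℝ) (posEnc d b) ⟨j.val - d, by have := j.isLt; omega⟩


/-- Two-layer ReLU network `MLP(x) = W₂ σ(W₁ x + b₁) + b₂`, where `σ` is the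
componentwise ReLU `σ(t)_j = max(t_j, 0)`. -/
noncomputable def mlp {dIn n m : ℕ}
    (W₁ : Matrix (Fin n) (Fin dIn) ℝ) (b₁ : Fin n → ℝ)
    (W₂ : Matrix (Fin m) (Fin n) ℝ) (b₂ : Fin m → ℝ)
    (x : EuclideanSpace ℝ (Fin dIn)) : EuclideanSpace ℝ (Fin m) :=
  (WithLp.equiv 2 (Fin m → ℝ)).symm
    (W₂.mulVec (fun j => max ((W₁.mulVec (WithLp.equiv 2 (Fin dIn → ℝ) x) + b₁) j) 0) + b₂)


/-- The positional–interaction encoder `Enc_PI(a,b) = MLP([p_a ‖ p_b])`. -/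
noncomputable def encPI (d n m : ℕ)
    (W₁ : Matrix (Fin n) (Fin (2 * d)) ℝ) (b₁ : Fin n → ℝ)
    (W₂ : Matrix (Fin m) (Fin n) ℝ) (b₂ : Fin m → ℝ)
    (a b : ℝ) : EuclideanSpace ℝ (Fin m) :=
  mlp W₁ b₁ W₂ b₂ (concatEnc d a b)

/-- Rectangular identity matrix. -/
def rectId (m n : ℕ) : Matrix (Fin m) (Fin n) ℝ :=
  fun i j => if i.val = j.val then 1 else 0

lemma rectId_mulVec {m n : ℕ} (v : Fin n → ℝ) (k : ℕ) (hm : k < m) (hn : k < n) :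
    (rectId m n).mulVec v ⟨k, hm⟩ = v ⟨k, hn⟩ := by
  simp only [Matrix.mulVec, dotProduct, rectId, ite_mul, one_mul, zero_mul]
  rw [Finset.sum_eq_single (⟨k, hn⟩ : Fin n)]
  · simp
  · intro j _ hj
    exact if_neg fun h => hj (Fin.ext h.symm)
  · simp

lemma neg_one_le_posEnc (d : ℕ) (a : ℝ) (j : Fin d) : -1 ≤ posEnc d a j := by
  simp only [posEnc, WithLp.equiv_symm_apply_ofLp]
  split_ifs
  · exact Real.neg_one_le_sin _
  · exact Real.neg_one_le_cos _

lemma neg_one_le_concatEnc (d : ℕ) (a b : ℝ) (j : Fin (2 * d)) : -1 ≤ concatEnc d a b j := by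
  simp only [concatEnc, WithLp.equiv_symm_apply_ofLp]
  split_ifs
  · exact neg_one_le_posEnc _ _ _
  · exact neg_one_le_posEnc _ _ _

/-- With identity weights and unit inner bias the ReLU acts as the identity on every encoding. -/
lemma encPI_rectId_apply {d n m : ℕ} (hn : 2 * d ≤ n) (hm : 2 * d ≤ m) (a b : ℝ)
    (k : Fin (2 * d)) :
    encPI d n m (rectId n (2 * d)) 1 (rectId m n) 0 a b (Fin.castLE hm k) =
      concatEnc d a b k + 1 := by
  have hk := k.isLt
  change ((rectId m n).mulVec _ + 0) ⟨k.val, by omega⟩ = _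
  rw [add_zero, rectId_mulVec _ _ _ (hk.trans_le hn), Pi.add_apply,
    rectId_mulVec _ _ _ hk]
  have h : 0 ≤ concatEnc d a b k + 1 := by linarith [neg_one_le_concatEnc d a b k]
  exact max_eq_left h

lemma concatEnc_left (d : ℕ) (a b : ℝ) (j : Fin d) :
    concatEnc d a b ⟨j.val, by omega⟩ = posEnc d a j := by
  simp [concatEnc]

lemma concatEnc_right (d : ℕ) (a b : ℝ) (j : Fin d) :
    concatEnc d a b ⟨d + j.val, by omega⟩ = posEnc d b j := by
  simp [concatEnc]

lemma posEnc_apply_zero {d : ℕ} (hd : 2 ≤ d) (a : ℝ) :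
    posEnc d a ⟨0, by omega⟩ = Real.sin a := by
  simp [posEnc, omegaFreq]

lemma posEnc_apply_one {d : ℕ} (hd : 2 ≤ d) (a : ℝ) :
    posEnc d a ⟨1, by omega⟩ = Real.cos a := by
  simp [posEnc, omegaFreq]

lemma posEnc_natCast_injective {d : ℕ} (hd : 2 ≤ d) :
    Function.Injective fun a : ℕ => posEnc d (a : ℝ) := by
  intro a b h
  replace h : posEnc d a = posEnc d b := h
  have hs : Real.sin a = Real.sin b := by
    rw [← posEnc_apply_zero hd, ← posEnc_apply_zero hd, h]
  have hc : Real.cos a = Real.cos b := by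
    rw [← posEnc_apply_one hd, ← posEnc_apply_one hd, h]
  obtain ⟨k, hk⟩ := Real.Angle.angle_eq_iff_two_pi_dvd_sub.mp
    (Real.Angle.cos_sin_inj hc hs)
  rcases eq_or_ne k 0 with rfl | hk0
  · exact_mod_cast sub_eq_zero.mp (by simpa using hk : (a : ℝ) - b = 0)
  · have hirr := (irrational_pi.mul_intCast (mul_ne_zero two_ne_zero hk0)).ne_int (a - b)
    push_cast at hirr
    exact absurd (by linarith) hirr

/-- For an even integer `d ≥ 4` with `10 ^ (8/d)` irrational and widths `n, m ≥ 2d`,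
there exist parameters making the positional–interaction encoder
`Enc_PI(a,b) = MLP([p_a ‖ p_b])` injective on pairs of positive integers. -/
theorem exists_params_encPI_injective
    (d n m : ℕ) (heven : Even d) (hd : 4 ≤ d)
    (hirr : Irrational ((10 : ℝ) ^ ((8 : ℝ) / (d : ℝ))))
    (hn : 2 * d ≤ n) (hm : 2 * d ≤ m) :
    ∃ (W₁ : Matrix (Fin n) (Fin (2 * d)) ℝ) (b₁ : Fin n → ℝ)
      (W₂ : Matrix (Fin m) (Fin n) ℝ) (b₂ : Fin m → ℝ),
      ∀ a b a' b' : ℕ, 0 < a → 0 < b → 0 < a' → 0 < b' →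
        (a, b) ≠ (a', b') →
        encPI d n m W₁ b₁ W₂ b₂ (a : ℝ) (b : ℝ) ≠
          encPI d n m W₁ b₁ W₂ b₂ (a' : ℝ) (b' : ℝ) := by
  refine ⟨rectId n (2 * d), 1, rectId m n, 0, ?_⟩
  intro a b a' b' _ _ _ _ hne h
  have hE (k : Fin (2 * d)) : concatEnc d a b k = concatEnc d a' b' k := by
    simpa [encPI_rectId_apply hn hm] using congrArg (fun v => v (Fin.castLE hm k)) h
  have hd2 : 2 ≤ d := by omega
  refine hne (Prod.ext (posEnc_natCast_injective hd2 ?_) (posEnc_natCast_injective hd2 ?_))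
  · ext j
    simpa only [concatEnc_left] using hE ⟨j.val, by omega⟩
  · ext j
    simpa only [concatEnc_right] using hE ⟨d + j.val, by omega⟩
end
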